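/- Let k be a positive integer written uniquely as k = 2^a(8t+α) with a,t nonnegative integers and α ∈ {1,3,5,7}. Then the number of (x,y,z) ∈ ℤ³ with x²+16y²+16z² = k equals: (1/6)𝔯₁(k) + δ_□(k)·(−1)^((√k−1)/2)·√k if (a,α) = (0,1); (1/3)𝔯₁(k) if (a,α) ∈ {(2,1),(2,5)}; 𝔯₁(k) if a ≥ 4; and 0 in all remaining cases. -/

import Mathlib

/-- The number of representations of `k` as a sum of three squares. -/
noncomputable def r1 (k : ℕ) : ℕ :=
  Nat.card {v : ℤ × ℤ × ℤ // v.1 ^ 2 + v.2.1 ^ 2 + v.2.2 ^ 2 = (k : ℤ)}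

/-- `δ_□(k) · (−1)^((√k−1)/2) · √k`, as a rational number. -/
noncomputable def sqTerm (k : ℕ) : ℚ :=
  if IsSquare k then (-1 : ℚ) ^ ((Nat.sqrt k - 1) / 2) * (Nat.sqrt k : ℚ) else 0

/-- The parity sign `(-1)^u` of an integer. -/
def paritySign (u : ℤ) : ℤ := if u % 2 = 0 then 1 else -1

/-- The nontrivial Dirichlet character modulo `4`, on the integers. -/
def chiFour (n : ℤ) : ℤ := if n % 4 = 1 then 1 else if n % 4 = 3 then -1 else 0

lemma paritySign_neg (u : ℤ) : paritySign (-u) = paritySign u := by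
  unfold paritySign; grind

lemma chiFour_neg (n : ℤ) : chiFour (-n) = -chiFour n := by
  unfold chiFour; grind

lemma chiFour_two_mul_sub (c b : ℤ) (hb : b % 2 = 1) :
    chiFour (2 * c - b) = -(paritySign c * chiFour b) := by
  unfold chiFour paritySign; grind

lemma mem_Icc_of_mul_sq_le {p a M : ℤ} (hp : 0 < p) (h : p * a ^ 2 ≤ M) :
    a ∈ Finset.Icc (-M) M := by
  rw [Finset.mem_Icc]
  have h1 : a ^ 2 ≤ p * a ^ 2 := by nlinarith [sq_nonneg a]
  constructor <;> nlinarith [Int.le_self_sq a, Int.le_self_sq (-a)]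

lemma finite_diagonal_ternary {p q r : ℤ} (hp : 0 < p) (hq : 0 < q) (hr : 0 < r) (M : ℤ)
    (C : ℤ × ℤ × ℤ → Prop) :
    {v : ℤ × ℤ × ℤ | C v ∧ p * v.1 ^ 2 + q * v.2.1 ^ 2 + r * v.2.2 ^ 2 = M}.Finite := by
  refine (Finset.finite_toSet
    (Finset.Icc (-M) M ×ˢ Finset.Icc (-M) M ×ˢ Finset.Icc (-M) M)).subset ?_
  rintro ⟨x, y, z⟩ ⟨-, h⟩
  have hx : 0 ≤ p * x ^ 2 := by positivity
  have hy : 0 ≤ q * y ^ 2 := by positivity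
  have hz : 0 ≤ r * z ^ 2 := by positivity
  simp only at h
  simp only [Finset.coe_product, Set.mem_prod, Finset.mem_coe]
  exact ⟨mem_Icc_of_mul_sq_le hp (by linarith), mem_Icc_of_mul_sq_le hq (by linarith),
    mem_Icc_of_mul_sq_le hr (by linarith)⟩

lemma finite_diagonal_quaternary {p q r s : ℤ} (hp : 0 < p) (hq : 0 < q) (hr : 0 < r)
    (hs : 0 < s) (M : ℤ) (C : ℤ × ℤ × ℤ × ℤ → Prop) :
    {v : ℤ × ℤ × ℤ × ℤ | C v ∧
      p * v.1 ^ 2 + q * v.2.1 ^ 2 + r * v.2.2.1 ^ 2 + s * v.2.2.2 ^ 2 = M}.Finite := by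
  refine (Finset.finite_toSet (Finset.Icc (-M) M ×ˢ Finset.Icc (-M) M ×ˢ
    Finset.Icc (-M) M ×ˢ Finset.Icc (-M) M)).subset ?_
  rintro ⟨x, y, z, w⟩ ⟨-, h⟩
  have hx : 0 ≤ p * x ^ 2 := by positivity
  have hy : 0 ≤ q * y ^ 2 := by positivity
  have hz : 0 ≤ r * z ^ 2 := by positivity
  have hw : 0 ≤ s * w ^ 2 := by positivity
  simp only at h
  simp only [Finset.coe_product, Set.mem_prod, Finset.mem_coe]
  exact ⟨mem_Icc_of_mul_sq_le hp (by linarith), mem_Icc_of_mul_sq_le hq (by linarith),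
    mem_Icc_of_mul_sq_le hr (by linarith), mem_Icc_of_mul_sq_le hs (by linarith)⟩

/-- Solutions `(x, u, v)` of `x² + 8u² + 8v² = k` with `x` odd. -/
noncomputable def oddTriples (k : ℤ) : Finset (ℤ × ℤ × ℤ) :=
  (finite_diagonal_ternary (p := 1) (q := 8) (r := 8) (by norm_num) (by norm_num) (by norm_num) k
    (fun v => v.1 % 2 = 1)).toFinset

/-- Odd square roots of `k`. -/
noncomputable def oddRoots (k : ℤ) : Finset ℤ := (Finset.Icc (-k) k).filter (fun m => m % 2 = 1 ∧ m ^ 2 = k)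

/-- Solutions `(x, n, u, v)` of `x² + n² + 8u² + 8v² = M` with `x` and `n` odd. -/
noncomputable def oddQuadruples (M : ℤ) : Finset (ℤ × ℤ × ℤ × ℤ) :=
  (finite_diagonal_quaternary (p := 1) (q := 1) (r := 8) (s := 8) (by norm_num) (by norm_num)
    (by norm_num) (by norm_num) M (fun v => v.1 % 2 = 1 ∧ v.2.1 % 2 = 1)).toFinset

/-- Solutions `(b, c, u, v)` of `2b² + 8c² + 8u² + 8v² = M` with `b` odd. -/
noncomputable def rotatedQuadruples (M : ℤ) : Finset (ℤ × ℤ × ℤ × ℤ) :=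
  (finite_diagonal_quaternary (p := 2) (q := 8) (r := 8) (s := 8) (by norm_num) (by norm_num)
    (by norm_num) (by norm_num) M (fun v => v.1 % 2 = 1)).toFinset

lemma mem_oddTriples {k x u v : ℤ} :
    (x, u, v) ∈ oddTriples k ↔ x % 2 = 1 ∧ x ^ 2 + 8 * u ^ 2 + 8 * v ^ 2 = k := by
  simp [oddTriples]

lemma mem_oddRoots {k m : ℤ} : m ∈ oddRoots k ↔ m % 2 = 1 ∧ m ^ 2 = k := by
  rw [oddRoots, Finset.mem_filter, and_iff_right_iff_imp]
  rintro ⟨-, h⟩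
  exact mem_Icc_of_mul_sq_le one_pos (by linarith)

lemma mem_oddQuadruples {M x n u v : ℤ} :
    (x, n, u, v) ∈ oddQuadruples M ↔
      (x % 2 = 1 ∧ n % 2 = 1) ∧ x ^ 2 + n ^ 2 + 8 * u ^ 2 + 8 * v ^ 2 = M := by
  simp [oddQuadruples]

lemma mem_rotatedQuadruples {M b c u v : ℤ} :
    (b, c, u, v) ∈ rotatedQuadruples M ↔
      b % 2 = 1 ∧ 2 * b ^ 2 + 8 * c ^ 2 + 8 * u ^ 2 + 8 * v ^ 2 = M := by
  simp [rotatedQuadruples]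

lemma sum_rotatedQuadruples_eq_zero (M : ℤ) :
    ∑ w ∈ rotatedQuadruples M, paritySign w.2.2.1 * paritySign w.2.2.2 *
      (chiFour (2 * w.2.1 - w.1) * (2 * w.2.1 - w.1) *
        (16 * w.2.2.1 ^ 2 + 8 * w.1 * w.2.1)) = 0 := by
  set g : ℤ × ℤ × ℤ × ℤ → ℤ := fun w => paritySign w.2.2.1 * paritySign w.2.2.2 *
      (chiFour (2 * w.2.1 - w.1) * (2 * w.2.1 - w.1) *
        (16 * w.2.2.1 ^ 2 + 8 * w.1 * w.2.1)) with hg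
  set G : ℤ × ℤ × ℤ × ℤ → ℤ := fun w => paritySign w.2.1 * paritySign w.2.2.1 *
    paritySign w.2.2.2 * chiFour w.1 * w.1 * (32 * (w.2.2.1 ^ 2 - w.2.1 ^ 2)) with hG
  have h1 : ∑ w ∈ rotatedQuadruples M, g w =
      ∑ w ∈ rotatedQuadruples M, g (w.1, -w.2.1, w.2.2) := by
    refine Finset.sum_nbij' (fun w => (w.1, -w.2.1, w.2.2)) (fun w => (w.1, -w.2.1, w.2.2))
      ?_ ?_ ?_ ?_ ?_ <;> rintro ⟨b, c, u, v⟩ <;> simp [mem_rotatedQuadruples]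
  have h2 : ∑ w ∈ rotatedQuadruples M, G w = ∑ w ∈ rotatedQuadruples M, -G w := by
    refine Finset.sum_nbij' (fun w => (w.1, w.2.2.1, w.2.1, w.2.2.2))
      (fun w => (w.1, w.2.2.1, w.2.1, w.2.2.2)) ?_ ?_ ?_ ?_ ?_ <;> rintro ⟨b, c, u, v⟩
    · simp only [mem_rotatedQuadruples]
      rintro ⟨h, h'⟩
      exact ⟨h, by linarith⟩
    · simp only [mem_rotatedQuadruples]
      rintro ⟨h, h'⟩
      exact ⟨h, by linarith⟩
    · simp
    · simp
    · intro _
      simp only [hG]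
      ring
  have h3 : ∑ w ∈ rotatedQuadruples M, (g w + g (w.1, -w.2.1, w.2.2)) =
      ∑ w ∈ rotatedQuadruples M, G w := by
    refine Finset.sum_congr rfl ?_
    rintro ⟨b, c, u, v⟩ hw
    rw [mem_rotatedQuadruples] at hw
    simp only [hg, hG, chiFour_two_mul_sub _ _ hw.1, paritySign_neg]
    ring
  rw [Finset.sum_neg_distrib] at h2
  rw [Finset.sum_add_distrib] at h3
  linarith

lemma sum_oddQuadruples_eq_zero (M : ℤ) :
    ∑ w ∈ oddQuadruples M, paritySign w.2.2.1 * paritySign w.2.2.2 *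
      (chiFour w.2.1 * w.2.1 * (M - 2 * w.2.1 ^ 2)) = 0 := by
  set h : ℤ × ℤ × ℤ × ℤ → ℤ := fun w => paritySign w.2.2.1 * paritySign w.2.2.2 *
    (chiFour w.2.1 * w.2.1 * (16 * w.2.2.1 ^ 2 + w.1 ^ 2 - w.2.1 ^ 2)) with hh
  set h' : ℤ × ℤ × ℤ × ℤ → ℤ := fun w => paritySign w.2.2.1 * paritySign w.2.2.2 *
    (chiFour w.2.1 * w.2.1 * (16 * w.2.2.2 ^ 2 + w.1 ^ 2 - w.2.1 ^ 2)) with hh'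
  have hswap : ∑ w ∈ oddQuadruples M, h w = ∑ w ∈ oddQuadruples M, h' w := by
    refine Finset.sum_nbij' (fun w => (w.1, w.2.1, w.2.2.2, w.2.2.1))
      (fun w => (w.1, w.2.1, w.2.2.2, w.2.2.1)) ?_ ?_ ?_ ?_ ?_ <;> rintro ⟨x, n, u, v⟩
    · simp only [mem_oddQuadruples]
      rintro ⟨h, h'⟩
      exact ⟨h, by linarith⟩
    · simp only [mem_oddQuadruples]
      rintro ⟨h, h'⟩
      exact ⟨h, by linarith⟩
    · simp
    · simp
    · intro _
      simp only [hh, hh']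
      ring
  have hsum : ∑ w ∈ oddQuadruples M, (h w + h' w) = 2 * ∑ w ∈ oddQuadruples M,
      paritySign w.2.2.1 * paritySign w.2.2.2 *
        (chiFour w.2.1 * w.2.1 * (M - 2 * w.2.1 ^ 2)) := by
    rw [Finset.mul_sum]
    refine Finset.sum_congr rfl ?_
    rintro ⟨x, n, u, v⟩ hw
    rw [mem_oddQuadruples] at hw
    simp only [hh, hh', ← hw.2]
    ring
  have hflip : ∑ w ∈ oddQuadruples M with ¬ (w.1 + w.2.1) % 4 = 0, h w =
      ∑ w ∈ oddQuadruples M with (w.1 + w.2.1) % 4 = 0, h w := by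
    refine Finset.sum_nbij' (fun w => (w.1, -w.2.1, w.2.2)) (fun w => (w.1, -w.2.1, w.2.2))
      ?_ ?_ ?_ ?_ ?_ <;> rintro ⟨x, n, u, v⟩
    · simp only [mem_oddQuadruples, Finset.mem_filter, neg_sq]
      rintro ⟨⟨⟨h1, h2⟩, h3⟩, h4⟩
      exact ⟨⟨⟨h1, by omega⟩, h3⟩, by omega⟩
    · simp only [mem_oddQuadruples, Finset.mem_filter, neg_sq]
      rintro ⟨⟨⟨h1, h2⟩, h3⟩, h4⟩
      exact ⟨⟨⟨h1, by omega⟩, h3⟩, by omega⟩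
    · simp
    · simp
    · intro _
      simp only [hh, chiFour_neg]
      ring
  have hrot : ∑ w ∈ oddQuadruples M with (w.1 + w.2.1) % 4 = 0, h w = 0 := by
    refine Eq.trans ?_ (sum_rotatedQuadruples_eq_zero M)
    refine Finset.sum_nbij'
      (fun w => ((w.1 - w.2.1) / 2, (w.1 + w.2.1) / 4, w.2.2))
      (fun w => (2 * w.2.1 + w.1, 2 * w.2.1 - w.1, w.2.2)) ?_ ?_ ?_ ?_ ?_ <;>
      rintro ⟨x, n, u, v⟩
    · simp only [mem_oddQuadruples, mem_rotatedQuadruples, Finset.mem_filter]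
      rintro ⟨⟨⟨h1, h2⟩, h3⟩, h4⟩
      obtain ⟨c, hc⟩ : ∃ c, c = (x + n) / 4 := ⟨_, rfl⟩
      obtain ⟨b, hb⟩ : ∃ b, b = (x - n) / 2 := ⟨_, rfl⟩
      rw [← hc, ← hb]
      obtain rfl : x = 2 * c + b := by omega
      obtain rfl : n = 2 * c - b := by omega
      exact ⟨by omega, by linarith⟩
    · simp only [mem_oddQuadruples, mem_rotatedQuadruples, Finset.mem_filter]
      rintro ⟨h1, h2⟩
      exact ⟨⟨⟨by omega, by omega⟩, by linarith⟩, by omega⟩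
    · simp only [mem_oddQuadruples, Finset.mem_filter, Prod.mk.injEq]
      rintro ⟨⟨⟨h1, h2⟩, h3⟩, h4⟩
      exact ⟨by omega, by omega, trivial⟩
    · simp only [Prod.mk.injEq]
      intro _
      exact ⟨by omega, by omega, trivial⟩
    · simp only [mem_oddQuadruples, Finset.mem_filter]
      rintro ⟨⟨⟨h1, h2⟩, h3⟩, h4⟩
      obtain ⟨c, hc⟩ : ∃ c, c = (x + n) / 4 := ⟨_, rfl⟩
      obtain ⟨b, hb⟩ : ∃ b, b = (x - n) / 2 := ⟨_, rfl⟩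
      simp only [hh]
      rw [← hc, ← hb]
      obtain rfl : x = 2 * c + b := by omega
      obtain rfl : n = 2 * c - b := by omega
      ring
  have hsplit := Finset.sum_filter_add_sum_filter_not (oddQuadruples M)
    (fun w => (w.1 + w.2.1) % 4 = 0) h
  rw [Finset.sum_add_distrib] at hsum
  linarith

/-- The coefficients of `φ(-q⁸)² · ∑ q^{x²}`, the sum being over odd `x`. -/
noncomputable def thetaCoeff (k : ℤ) : ℤ :=
  ∑ w ∈ oddTriples k, paritySign w.2.1 * paritySign w.2.2

/-- The coefficients of `∑ χ(n) n q^{n²}` over odd `n`. -/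
noncomputable def unaryCoeff (k : ℤ) : ℤ := ∑ n ∈ oddRoots k, chiFour n * n

lemma oddTriples_of_nonpos {k : ℤ} (hk : k ≤ 0) : oddTriples k = ∅ := by
  refine Finset.eq_empty_of_forall_notMem ?_
  rintro ⟨x, u, v⟩ h
  rw [mem_oddTriples] at h
  have hx : x = 0 := by nlinarith [sq_nonneg x, sq_nonneg u, sq_nonneg v]
  omega

lemma oddRoots_of_nonpos {k : ℤ} (hk : k ≤ 0) : oddRoots k = ∅ := by
  refine Finset.eq_empty_of_forall_notMem ?_
  intro x h
  rw [mem_oddRoots] at h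
  have hx : x = 0 := by nlinarith [sq_nonneg x]
  omega

lemma sum_mul_thetaCoeff_eq_zero (M : ℤ) :
    ∑ n ∈ Finset.Icc (-M) M with n % 2 = 1,
      chiFour n * n * (M - 2 * n ^ 2) * thetaCoeff (M - n ^ 2) = 0 := by
  rw [← sum_oddQuadruples_eq_zero M]
  simp only [thetaCoeff, Finset.mul_sum]
  rw [Finset.sum_sigma']
  refine Finset.sum_nbij' (fun w => (w.2.1, w.1, w.2.2))
    (fun w => ⟨w.2.1, w.1, w.2.2⟩) ?_ ?_ ?_ ?_ ?_
  · rintro ⟨n, x, u, v⟩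
    simp only [Finset.mem_sigma, Finset.mem_filter, mem_oddTriples, mem_oddQuadruples]
    rintro ⟨⟨-, h1⟩, h2, h3⟩
    exact ⟨⟨h2, h1⟩, by linarith⟩
  · rintro ⟨x, n, u, v⟩
    simp only [Finset.mem_sigma, Finset.mem_filter, mem_oddTriples, mem_oddQuadruples]
    rintro ⟨⟨h2, h1⟩, h3⟩
    exact ⟨⟨mem_Icc_of_mul_sq_le one_pos
      (by nlinarith [sq_nonneg x, sq_nonneg u, sq_nonneg v]), h1⟩, h2, by linarith⟩
  · rintro ⟨n, x, u, v⟩ _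
    rfl
  · rintro ⟨x, n, u, v⟩ _
    rfl
  · rintro ⟨n, x, u, v⟩ _
    ring

lemma sum_mul_unaryCoeff_eq_zero (M : ℤ) :
    ∑ n ∈ Finset.Icc (-M) M with n % 2 = 1,
      chiFour n * n * (M - 2 * n ^ 2) * unaryCoeff (M - n ^ 2) = 0 := by
  simp only [unaryCoeff, Finset.mul_sum]
  rw [Finset.sum_sigma']
  set s := ((Finset.Icc (-M) M).filter (fun n => n % 2 = 1)).sigma
    (fun n => oddRoots (M - n ^ 2)) with hs
  have hmem : ∀ n m : ℤ, (⟨n, m⟩ : Σ _ : ℤ, ℤ) ∈ s ↔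
      n % 2 = 1 ∧ m % 2 = 1 ∧ n ^ 2 + m ^ 2 = M := by
    intro n m
    simp only [hs, Finset.mem_sigma, Finset.mem_filter, mem_oddRoots]
    constructor
    · rintro ⟨⟨-, h1⟩, h2, h3⟩
      exact ⟨h1, h2, by linarith⟩
    · rintro ⟨h1, h2, h3⟩
      exact ⟨⟨mem_Icc_of_mul_sq_le one_pos (by nlinarith [sq_nonneg m]), h1⟩, h2, by linarith⟩
  have key : ∑ w ∈ s, chiFour w.1 * w.1 * (M - 2 * w.1 ^ 2) * (chiFour w.2 * w.2) =
      ∑ w ∈ s, -(chiFour w.1 * w.1 * (M - 2 * w.1 ^ 2) * (chiFour w.2 * w.2)) := by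
    refine Finset.sum_nbij' (fun w => ⟨w.2, w.1⟩) (fun w => ⟨w.2, w.1⟩) ?_ ?_ ?_ ?_ ?_ <;>
      rintro ⟨n, m⟩ <;> rw [hmem]
    · rintro ⟨h1, h2, h3⟩
      exact (hmem _ _).2 ⟨h2, h1, by linarith⟩
    · rintro ⟨h1, h2, h3⟩
      exact (hmem _ _).2 ⟨h2, h1, by linarith⟩
    · simp
    · simp
    · rintro ⟨-, -, rfl⟩
      ring
  rw [Finset.sum_neg_distrib] at key
  linarith

lemma thetaCoeff_one : thetaCoeff 1 = unaryCoeff 1 := by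
  have h1 : oddTriples 1 = {(1, 0, 0), (-1, 0, 0)} := by
    ext ⟨x, u, v⟩
    simp only [mem_oddTriples, Finset.mem_insert, Finset.mem_singleton, Prod.mk.injEq]
    constructor
    · rintro ⟨h, h'⟩
      have hu : u = 0 := by nlinarith [sq_nonneg x, sq_nonneg u, sq_nonneg v]
      have hv : v = 0 := by nlinarith [sq_nonneg x, sq_nonneg u, sq_nonneg v]
      subst hu hv
      have : x = 1 ∨ x = -1 := sq_eq_sq_iff_eq_or_eq_neg.1 (by linarith : x ^ 2 = 1 ^ 2)
      tauto
    · rintro (⟨rfl, rfl, rfl⟩ | ⟨rfl, rfl, rfl⟩) <;> norm_num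
  have h2 : oddRoots 1 = {1, -1} := by
    ext m
    simp only [mem_oddRoots, Finset.mem_insert, Finset.mem_singleton]
    rw [← one_pow (M := ℤ) 2, sq_eq_sq_iff_eq_or_eq_neg]
    omega
  rw [thetaCoeff, unaryCoeff, h1, h2]
  decide

/-- The Jacobi identity `φ(-q)² ψ(q) = ∑ (-1)ⁿ (2n+1) q^{n(n+1)/2}`, coefficientwise. -/
lemma thetaCoeff_eq_unaryCoeff (k : ℕ) : thetaCoeff k = unaryCoeff k := by
  induction k using Nat.strong_induction_on with
  | _ k ih =>
  rcases Nat.lt_or_ge k 2 with hk | hk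
  · interval_cases k
    · simp [thetaCoeff, unaryCoeff, oddTriples_of_nonpos, oddRoots_of_nonpos]
    · exact_mod_cast thetaCoeff_one
  have hlt : ∀ m : ℤ, m < k → thetaCoeff m - unaryCoeff m = 0 := by
    intro m hm
    rcases le_or_gt m 0 with h0 | h0
    · simp [thetaCoeff, unaryCoeff, oddTriples_of_nonpos h0, oddRoots_of_nonpos h0]
    · lift m to ℕ using h0.le
      rw [ih m (by exact_mod_cast hm), sub_self]
  set M : ℤ := k + 1 with hM
  have h : ∑ n ∈ Finset.Icc (-M) M with n % 2 = 1,
      chiFour n * n * (M - 2 * n ^ 2) *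
        (thetaCoeff (M - n ^ 2) - unaryCoeff (M - n ^ 2)) = 0 := by
    simp only [mul_sub _ (thetaCoeff _) _, Finset.sum_sub_distrib]
    rw [sum_mul_thetaCoeff_eq_zero, sum_mul_unaryCoeff_eq_zero, sub_zero]
  have hsub : ({1, -1} : Finset ℤ) ⊆ (Finset.Icc (-M) M).filter (fun n => n % 2 = 1) := by
    intro n hn
    simp only [Finset.mem_insert, Finset.mem_singleton] at hn
    simp only [Finset.mem_filter, Finset.mem_Icc]
    omega
  rw [← Finset.sum_subset hsub] at h
  · rw [Finset.sum_pair (by norm_num)] at h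
    have e1 : M - 1 ^ 2 = k := by rw [hM]; ring
    have e2 : M - (-1) ^ 2 = k := by rw [hM]; ring
    have c1 : chiFour 1 = 1 := by decide
    have c2 : chiFour (-1) = -1 := by decide
    rw [e1, e2, c1, c2] at h
    have h' : ((k : ℤ) - 1) * (thetaCoeff k - unaryCoeff k) = 0 := by
      rw [hM] at h
      linarith
    rcases mul_eq_zero.1 h' with h0 | h0
    · omega
    · linarith
  · intro n hn hn'
    simp only [Finset.mem_filter, Finset.mem_insert, Finset.mem_singleton, not_or] at hn hn'
    rw [hlt, mul_zero]
    have : 3 ≤ n ∨ n ≤ -3 := by omega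
    rcases this with h3 | h3 <;> nlinarith

lemma unaryCoeff_eq_sqTerm (k : ℕ) (hk : k % 2 = 1) : (unaryCoeff k : ℚ) = 2 * sqTerm k := by
  unfold unaryCoeff sqTerm
  split_ifs with h
  · obtain ⟨n, rfl⟩ := h
    have hn : n % 2 = 1 := by
      rcases Nat.mod_two_eq_zero_or_one n with h0 | h0
      · rw [Nat.mul_mod, h0] at hk
        omega
      · exact h0
    have hroots : oddRoots ((n * n : ℕ) : ℤ) = {(n : ℤ), -(n : ℤ)} := by
      ext m
      simp only [mem_oddRoots, Finset.mem_insert, Finset.mem_singleton]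
      rw [Nat.cast_mul, ← pow_two, sq_eq_sq_iff_eq_or_eq_neg]
      omega
    rw [hroots, Finset.sum_pair (by omega), Nat.sqrt_eq, chiFour_neg]
    have hchi : (chiFour n : ℚ) = (-1) ^ ((n - 1) / 2) := by
      obtain ⟨j, hj⟩ : ∃ j, j = (n - 1) / 2 := ⟨_, rfl⟩
      rw [← hj]
      obtain rfl : n = 2 * j + 1 := by omega
      rcases Nat.even_or_odd' j with ⟨i, rfl | rfl⟩
      · have : chiFour ((2 * (2 * i) + 1 : ℕ) : ℤ) = 1 := by unfold chiFour; grind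
        rw [this]; simp
      · have : chiFour ((2 * (2 * i + 1) + 1 : ℕ) : ℤ) = -1 := by unfold chiFour; grind
        rw [this]; simp [pow_succ]
    push_cast
    rw [hchi]
    ring
  · have : oddRoots (k : ℤ) = ∅ := by
      refine Finset.eq_empty_of_forall_notMem ?_
      intro m hm
      rw [mem_oddRoots] at hm
      exact h ⟨m.natAbs, by zify; rw [← pow_two, sq_abs, hm.2]⟩
    simp [this]

/-- Representations of `k` as a sum of three squares. -/
noncomputable def threeSquares (k : ℤ) : Finset (ℤ × ℤ × ℤ) :=
  (finite_diagonal_ternary (p := 1) (q := 1) (r := 1) one_pos one_pos one_pos k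
    (fun _ => True)).toFinset

lemma mem_threeSquares {k x y z : ℤ} :
    (x, y, z) ∈ threeSquares k ↔ x ^ 2 + y ^ 2 + z ^ 2 = k := by
  simp [threeSquares]

lemma card_threeSquares (k : ℕ) : (threeSquares k).card = r1 k := by
  rw [r1, ← Nat.card_eq_finsetCard]
  refine Nat.card_congr (Equiv.subtypeEquivRight ?_)
  rintro ⟨x, y, z⟩
  exact mem_threeSquares

lemma card_rep_eq_card_filter (k : ℕ) :
    Nat.card {v : ℤ × ℤ × ℤ // v.1 ^ 2 + 16 * v.2.1 ^ 2 + 16 * v.2.2 ^ 2 = (k : ℤ)} =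
      ((threeSquares k).filter (fun v => 4 ∣ v.2.1 ∧ 4 ∣ v.2.2)).card := by
  rw [← Nat.card_eq_finsetCard]
  refine Nat.card_congr
    { toFun := fun v => ⟨(v.1.1, 4 * v.1.2.1, 4 * v.1.2.2), ?_⟩
      invFun := fun v => ⟨(v.1.1, v.1.2.1 / 4, v.1.2.2 / 4), ?_⟩
      left_inv := ?_
      right_inv := ?_ }
  · obtain ⟨⟨x, y, z⟩, h⟩ := v
    simp only [Finset.mem_filter, mem_threeSquares] at h ⊢
    exact ⟨by linarith, dvd_mul_right _ _, dvd_mul_right _ _⟩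
  · obtain ⟨⟨x, y, z⟩, h⟩ := v
    simp only [Finset.mem_filter, mem_threeSquares] at h ⊢
    obtain ⟨h, ⟨y, rfl⟩, ⟨z, rfl⟩⟩ := h
    rw [Int.mul_ediv_cancel_left _ (by norm_num), Int.mul_ediv_cancel_left _ (by norm_num)]
    linarith
  · rintro ⟨⟨x, y, z⟩, h⟩
    simp
  · rintro ⟨⟨x, y, z⟩, h⟩
    simp only [Finset.mem_filter, mem_threeSquares] at h
    simp [Int.mul_ediv_cancel' h.2.1, Int.mul_ediv_cancel' h.2.2]

lemma card_threeSquares_eq_three_mul (k d : ℤ)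
    (h : ∀ x y z : ℤ, x ^ 2 + y ^ 2 + z ^ 2 = k →
      (¬ d ∣ x ∧ d ∣ y ∧ d ∣ z) ∨ (d ∣ x ∧ ¬ d ∣ y ∧ d ∣ z) ∨ (d ∣ x ∧ d ∣ y ∧ ¬ d ∣ z)) :
    (threeSquares k).card =
      3 * ((threeSquares k).filter (fun v => d ∣ v.2.1 ∧ d ∣ v.2.2)).card := by
  set F := (threeSquares k).filter (fun v => d ∣ v.2.1 ∧ d ∣ v.2.2) with hF
  have h1 : ((threeSquares k).filter (fun v => d ∣ v.1 ∧ d ∣ v.2.1)).card = F.card := by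
    refine Finset.card_nbij' (fun v => (v.2.2, v.2.1, v.1)) (fun v => (v.2.2, v.2.1, v.1))
      ?_ ?_ ?_ ?_ <;> rintro ⟨x, y, z⟩ <;>
      simp only [hF, Finset.coe_filter, Set.mem_ofPred_eq, mem_threeSquares]
    · rintro ⟨h1, h2, h3⟩
      exact ⟨by linarith, h3, h2⟩
    · rintro ⟨h1, h2, h3⟩
      exact ⟨by linarith, h3, h2⟩
    · simp
    · simp
  have h2 : ((threeSquares k).filter (fun v => d ∣ v.1 ∧ d ∣ v.2.2)).card = F.card := by
    refine Finset.card_nbij' (fun v => (v.2.1, v.1, v.2.2)) (fun v => (v.2.1, v.1, v.2.2))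
      ?_ ?_ ?_ ?_ <;> rintro ⟨x, y, z⟩ <;>
      simp only [hF, Finset.coe_filter, Set.mem_ofPred_eq, mem_threeSquares]
    · rintro ⟨h1, h2, h3⟩
      exact ⟨by linarith, h2, h3⟩
    · rintro ⟨h1, h2, h3⟩
      exact ⟨by linarith, h2, h3⟩
    · simp
    · simp
  have h3 : (threeSquares k).card = F.card +
      ((threeSquares k).filter (fun v => d ∣ v.1 ∧ d ∣ v.2.2)).card +
      ((threeSquares k).filter (fun v => d ∣ v.1 ∧ d ∣ v.2.1)).card := by
    rw [hF, Finset.card_filter, Finset.card_filter, Finset.card_filter,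
      ← Finset.sum_add_distrib, ← Finset.sum_add_distrib, Finset.card_eq_sum_ones]
    refine Finset.sum_congr rfl ?_
    rintro ⟨x, y, z⟩ hv
    rcases h x y z (mem_threeSquares.1 hv) with h | h | h <;> simp [h]
  omega

lemma sq_emod_sixteen (x : ℤ) :
    (x % 4 = 0 ∧ x ^ 2 % 16 = 0) ∨ (x % 4 = 2 ∧ x ^ 2 % 16 = 4) ∨
      (x % 2 = 1 ∧ (x ^ 2 % 16 = 1 ∨ x ^ 2 % 16 = 9)) := by
  obtain ⟨q, r, hr, rfl⟩ : ∃ q r : ℤ, (0 ≤ r ∧ r < 8) ∧ x = 8 * q + r :=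
    ⟨x / 8, x % 8, by omega, by omega⟩
  have : (8 * q + r) ^ 2 = 16 * (4 * q ^ 2 + q * r) + r ^ 2 := by ring
  rw [this]
  obtain ⟨h0, h8⟩ := hr
  interval_cases r <;> omega

lemma card_oddTriples (k : ℕ) (hk : k % 8 = 1) :
    (oddTriples k).card =
      ((threeSquares k).filter (fun v => 2 ∣ v.2.1 ∧ 2 ∣ v.2.2)).card := by
  refine Finset.card_nbij' (fun w => (w.1, 2 * (w.2.1 + w.2.2), 2 * (w.2.1 - w.2.2)))
    (fun w => (w.1, (w.2.1 + w.2.2) / 4, (w.2.1 - w.2.2) / 4)) ?_ ?_ ?_ ?_ <;>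
    rintro ⟨x, y, z⟩ <;>
    simp only [Finset.coe_filter, Set.mem_ofPred_eq, mem_threeSquares, Finset.mem_coe,
      mem_oddTriples, Prod.mk.injEq]
  · rintro ⟨h1, h2⟩
    exact ⟨by linarith, dvd_mul_right _ _, dvd_mul_right _ _⟩
  · rintro ⟨h1, h2, h3⟩
    have hx := sq_emod_sixteen x
    have hy := sq_emod_sixteen y
    have hz := sq_emod_sixteen z
    obtain ⟨u, hu⟩ : ∃ u, u = (y + z) / 4 := ⟨_, rfl⟩
    obtain ⟨v, hv⟩ : ∃ v, v = (y - z) / 4 := ⟨_, rfl⟩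
    rw [← hu, ← hv]
    obtain rfl : y = 2 * (u + v) := by omega
    obtain rfl : z = 2 * (u - v) := by omega
    exact ⟨by omega, by linarith⟩
  · intro _
    exact ⟨trivial, by omega, by omega⟩
  · rintro ⟨h1, h2, h3⟩
    have hx := sq_emod_sixteen x
    have hy := sq_emod_sixteen y
    have hz := sq_emod_sixteen z
    exact ⟨trivial, by omega, by omega⟩

lemma thetaCoeff_eq_two_mul_card_sub (k : ℕ) (hk : k % 2 = 1) :
    thetaCoeff k = 2 * ((threeSquares k).filter (fun v => 4 ∣ v.2.1 ∧ 4 ∣ v.2.2)).card -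
      (oddTriples k).card := by
  have h1 : ((oddTriples k).filter (fun w => (w.2.1 + w.2.2) % 2 = 0)).card =
      ((threeSquares k).filter (fun v => 4 ∣ v.2.1 ∧ 4 ∣ v.2.2)).card := by
    refine Finset.card_nbij' (fun w => (w.1, 2 * (w.2.1 + w.2.2), 2 * (w.2.1 - w.2.2)))
      (fun w => (w.1, (w.2.1 + w.2.2) / 4, (w.2.1 - w.2.2) / 4)) ?_ ?_ ?_ ?_ <;>
      rintro ⟨x, y, z⟩ <;>
      simp only [Finset.coe_filter, Set.mem_ofPred_eq, mem_threeSquares,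
        mem_oddTriples, Prod.mk.injEq]
    · rintro ⟨⟨h1, h2⟩, h3⟩
      exact ⟨by linarith, by omega, by omega⟩
    · rintro ⟨h1, ⟨y, rfl⟩, ⟨z, rfl⟩⟩
      have hx := sq_emod_sixteen x
      have hy : (4 * y + 4 * z) / 4 = y + z := by omega
      have hz : (4 * y - 4 * z) / 4 = y - z := by omega
      rw [hy, hz]
      refine ⟨⟨?_, by linarith⟩, by omega⟩
      have e : x ^ 2 + 16 * (y ^ 2 + z ^ 2) = k := by linarith
      omega
    · intro _
      exact ⟨trivial, by omega, by omega⟩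
    · intro _
      exact ⟨trivial, by omega, by omega⟩
  rw [← h1, thetaCoeff, Finset.card_filter, Finset.card_eq_sum_ones]
  push_cast
  rw [Finset.mul_sum, ← Finset.sum_sub_distrib]
  refine Finset.sum_congr rfl ?_
  rintro ⟨x, u, v⟩ _
  unfold paritySign
  split_ifs <;> omega

lemma card_rep_of_mod_eight_eq_one (k : ℕ) (hk : k % 8 = 1) :
    (Nat.card {v : ℤ × ℤ × ℤ // v.1 ^ 2 + 16 * v.2.1 ^ 2 + 16 * v.2.2 ^ 2 = (k : ℤ)} : ℚ) =
      (1 / 6 : ℚ) * r1 k + sqTerm k := by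
  have h1 := card_threeSquares_eq_three_mul k 2 (by
    intro x y z h
    have hx := sq_emod_sixteen x
    have hy := sq_emod_sixteen y
    have hz := sq_emod_sixteen z
    omega)
  rw [← card_oddTriples k hk, card_threeSquares] at h1
  have h2 := thetaCoeff_eq_two_mul_card_sub k (by omega)
  have h3 := unaryCoeff_eq_sqTerm k (by omega)
  rw [← thetaCoeff_eq_unaryCoeff, h2] at h3
  rw [card_rep_eq_card_filter, h1]
  push_cast at h3 ⊢
  linarith

theorem stmt_3 (a t α : ℕ) (hα : α = 1 ∨ α = 3 ∨ α = 5 ∨ α = 7)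
    (k : ℕ) (hk : k = 2 ^ a * (8 * t + α)) :
    (Nat.card {v : ℤ × ℤ × ℤ // v.1 ^ 2 + 16 * v.2.1 ^ 2 + 16 * v.2.2 ^ 2 = (k : ℤ)} : ℚ) =
      if a = 0 ∧ α = 1 then (1 / 6 : ℚ) * r1 k + sqTerm k
      else if (a = 2 ∧ α = 1) ∨ (a = 2 ∧ α = 5) then (1 / 3 : ℚ) * r1 k
      else if 4 ≤ a then (r1 k : ℚ)
      else 0 := by
  have hcast : (k : ℤ) = 2 ^ a * (8 * t + α) := by rw [hk]; push_cast; ring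
  rcases Nat.lt_or_ge a 4 with ha | ha
  · by_cases h01 : a = 0 ∧ α = 1
    · rw [if_pos h01]
      obtain ⟨rfl, rfl⟩ := h01
      exact card_rep_of_mod_eight_eq_one k (by omega)
    rw [if_neg h01, card_rep_eq_card_filter]
    by_cases h2 : (a = 2 ∧ α = 1) ∨ (a = 2 ∧ α = 5)
    · rw [if_pos h2, ← card_threeSquares, card_threeSquares_eq_three_mul k 4]
      · push_cast
        ring
      · intro x y z h
        have hx := sq_emod_sixteen x
        have hy := sq_emod_sixteen y
        have hz := sq_emod_sixteen z
        obtain rfl : a = 2 := by omega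
        omega
    · rw [if_neg h2, if_neg (by omega), Nat.cast_eq_zero, Finset.card_eq_zero]
      refine Finset.filter_eq_empty_iff.2 ?_
      rintro ⟨x, y, z⟩ hv
      rw [mem_threeSquares] at hv
      rintro ⟨hy4, hz4⟩
      have hx := sq_emod_sixteen x
      have hy := sq_emod_sixteen y
      have hz := sq_emod_sixteen z
      simp only at hy4 hz4
      interval_cases a <;> omega
  · rw [if_neg (by omega), if_neg (by omega), if_pos ha, card_rep_eq_card_filter,
      ← card_threeSquares, Finset.filter_true_of_mem]
    rintro ⟨x, y, z⟩ hv
    rw [mem_threeSquares] at hv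
    obtain ⟨b, rfl⟩ := Nat.exists_eq_add_of_le ha
    have h16 : (k : ℤ) = 16 * (2 ^ b * (8 * t + α)) := by rw [hcast, pow_add]; ring
    have hx := sq_emod_sixteen x
    have hy := sq_emod_sixteen y
    have hz := sq_emod_sixteen z
    simp only
    omega
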